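/- Let m ≥ 1 be an integer and suppose g ∈ L²(dν)q⁰ satisfies Δ^m g = f₀. Then for every N ∈ ℕ: g(q^{2N}) = ((−1)^m h/(2π)) (1−q²)^{2m} (q²;q²)_∞ ∫_0^{2π/h} ψ_ρ(q^{2N}) (q^{−4iρ};q²)_∞ / ((1−q^{1+2iρ})^m (1−q^{1−2iρ})^m ((q^{1−2iρ};q²)_∞)²) dρ, the integral being with respect to Lebesgue measure on [0, 2π/h]. -/

import Mathlib

open scoped BigOperators
open Complex

noncomputable section

/-- `q^w = exp(w · ln q)` for real `q > 0` and complex `w`. -/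
noncomputable def qpow (q : ℝ) (w : ℂ) : ℂ := Complex.exp (w * (Real.log q : ℂ))

/-- The finite q-Pochhammer symbol `(a;Q)_n = ∏_{j=0}^{n-1} (1 − a Q^j)`. -/
noncomputable def qPoch (a Q : ℂ) (n : ℕ) : ℂ := ∏ j ∈ Finset.range n, (1 - a * Q ^ j)

/-- The infinite q-Pochhammer symbol `(a;Q)_∞ = ∏_{j=0}^{∞} (1 − a Q^j)`. -/
noncomputable def qPochInf (a Q : ℂ) : ℂ := ∏' j : ℕ, (1 - a * Q ^ j)

/-- The eigenvalue `λ(ρ) = −(1−q^{1+2iρ})(1−q^{1−2iρ})/(1−q²)²`. -/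
noncomputable def lambdaQ (q : ℝ) (ρ : ℂ) : ℂ :=
  -((1 - qpow q (1 + 2 * I * ρ)) * (1 - qpow q (1 - 2 * I * ρ))) / (1 - (q : ℂ) ^ 2) ^ 2

/-- The general term of the series defining the Jost-type solution `ψ_ρ(q^{2m})`. -/
noncomputable def psiTerm (q : ℝ) (ρ : ℂ) (m k : ℕ) : ℂ :=
  (qPoch (qpow q (1 - 2 * I * ρ)) ((q : ℂ) ^ 2) k) ^ 2 * (q : ℂ) ^ (2 * k) *
      (q : ℂ) ^ (2 * k * m) /
    (qPoch (qpow q (2 - 4 * I * ρ)) ((q : ℂ) ^ 2) k * qPoch ((q : ℂ) ^ 2) ((q : ℂ) ^ 2) k)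

/-- The Jost-type solution
`ψ_ρ(q^{2m}) = q^{(1−2iρ)m} Σ_{k≥0} ((q^{1−2iρ};q²)_k)² q^{2k} q^{2km} / ((q^{2−4iρ};q²)_k (q²;q²)_k)`. -/
noncomputable def psiQ (q : ℝ) (ρ : ℂ) (m : ℕ) : ℂ :=
  qpow q ((1 - 2 * I * ρ) * (m : ℂ)) * ∑' k : ℕ, psiTerm q ρ m k

/-- The q-spherical function
`φ_ρ(q^{2m}) = Σ_{k=0}^{m} (q^{-2m};q²)_k (q^{1+2iρ};q²)_k (q^{1−2iρ};q²)_k q^{2k} / ((q²;q²)_k)²`. -/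
noncomputable def phiQ (q : ℝ) (ρ : ℂ) (m : ℕ) : ℂ :=
  ∑ k ∈ Finset.range (m + 1),
    qPoch ((q : ℂ) ^ (-(2 * (m : ℤ)))) ((q : ℂ) ^ 2) k *
        qPoch (qpow q (1 + 2 * I * ρ)) ((q : ℂ) ^ 2) k *
        qPoch (qpow q (1 - 2 * I * ρ)) ((q : ℂ) ^ 2) k * (q : ℂ) ^ (2 * k) /
      (qPoch ((q : ℂ) ^ 2) ((q : ℂ) ^ 2) k) ^ 2

/-- The radial part of the q-invariant Laplacian, acting on sequences `f : ℕ → ℂ` (where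
`f m` stands for `f(q^{2m})`); for `m = 0` the first bracketed term (carrying the factor
`1−q⁰ = 0`) is set equal to `0`. -/
noncomputable def DeltaQ (q : ℝ) (f : ℕ → ℂ) : ℕ → ℂ := fun m =>
  (q : ℂ) ^ (-1 : ℤ) * (q : ℂ) ^ (4 * (m : ℤ)) *
    ((if m = 0 then 0 else
        (1 - (q : ℂ) ^ (2 * (m : ℤ))) * (f (m - 1) - f m) /
          ((q : ℂ) ^ (2 * (m : ℤ) - 2) - (q : ℂ) ^ (2 * (m : ℤ)))) -
      (1 - (q : ℂ) ^ (2 * (m : ℤ) + 2)) * (f m - f (m + 1)) /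
        ((q : ℂ) ^ (2 * (m : ℤ)) - (q : ℂ) ^ (2 * (m : ℤ) + 2))) /
    ((q : ℂ) ^ (2 * (m : ℤ) - 1) - (q : ℂ) ^ (2 * (m : ℤ) + 1))

/-- `h = ln(q^{-2})`. -/
noncomputable def hQ (q : ℝ) : ℝ := Real.log (q ^ (-2 : ℤ))

/-- The q-analogue `f₀` of the delta-function at the centre of the disc:
`f₀(q⁰) = 1` and `f₀(q^{2k}) = 0` for `k ≥ 1`. -/
noncomputable def fZero : ℕ → ℂ := fun N => if N = 0 then 1 else 0

open Filter Topology Metric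

section Pochhammer

variable {Q : ℂ}

lemma summable_norm_mul_pow (hQ : ‖Q‖ < 1) (a : ℂ) : Summable fun j : ℕ => ‖-(a * Q ^ j)‖ := by
  simpa [norm_mul, norm_pow] using
    (summable_geometric_of_lt_one (norm_nonneg Q) hQ).mul_left ‖a‖

lemma multipliable_qPochInf (hQ : ‖Q‖ < 1) (a : ℂ) :
    Multipliable fun j : ℕ => 1 - a * Q ^ j := by
  simpa [sub_eq_add_neg] using multipliable_one_add_of_summable (summable_norm_mul_pow hQ a)

lemma tendsto_qPoch (hQ : ‖Q‖ < 1) (a : ℂ) :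
    Tendsto (qPoch a Q) atTop (𝓝 (qPochInf a Q)) :=
  (multipliable_qPochInf hQ a).hasProd.tendsto_prod_nat

lemma one_sub_mul_pow_ne_zero (hQ : ‖Q‖ < 1) {a : ℂ} (ha : ‖a‖ < 1) (j : ℕ) :
    1 - a * Q ^ j ≠ 0 := by
  intro h
  have h1 : ‖a * Q ^ j‖ < 1 := by
    rw [norm_mul, norm_pow]
    exact mul_lt_one_of_nonneg_of_lt_one_left (norm_nonneg a) ha
      (pow_le_one₀ (norm_nonneg Q) hQ.le)
  rw [← sub_eq_zero.mp h] at h1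
  simp at h1

lemma qPoch_ne_zero (hQ : ‖Q‖ < 1) {a : ℂ} (ha : ‖a‖ < 1) (k : ℕ) : qPoch a Q k ≠ 0 :=
  Finset.prod_ne_zero_iff.mpr fun j _ => one_sub_mul_pow_ne_zero hQ ha j

lemma qPochInf_ne_zero (hQ : ‖Q‖ < 1) {a : ℂ} (ha : ‖a‖ < 1) : qPochInf a Q ≠ 0 := by
  have := tprod_one_add_ne_zero_of_summable (f := fun j : ℕ => -(a * Q ^ j))
    (fun j => by simpa [sub_eq_add_neg] using one_sub_mul_pow_ne_zero hQ ha j)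
    (summable_norm_mul_pow hQ a)
  simpa [qPochInf, sub_eq_add_neg] using this

lemma qPoch_succ (a Q : ℂ) (k : ℕ) : qPoch a Q (k + 1) = qPoch a Q k * (1 - a * Q ^ k) :=
  Finset.prod_range_succ _ _

lemma qPoch_succ' (a Q : ℂ) (k : ℕ) : qPoch a Q (k + 1) = (1 - a) * qPoch (a * Q) Q k := by
  simp [qPoch, Finset.prod_range_succ', mul_comm, pow_succ, mul_assoc]

lemma qPochInf_eq_mul (hQ : ‖Q‖ < 1) (a : ℂ) : qPochInf a Q = (1 - a) * qPochInf (a * Q) Q := by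
  refine tendsto_nhds_unique ((tendsto_add_atTop_iff_nat 1).mpr (tendsto_qPoch hQ a)) ?_
  simpa only [qPoch_succ'] using (tendsto_qPoch hQ (a * Q)).const_mul (1 - a)

lemma differentiable_qPoch (Q : ℂ) (k : ℕ) : Differentiable ℂ fun a => qPoch a Q k := by
  unfold qPoch
  fun_prop

lemma differentiable_qPochInf (hQ : ‖Q‖ < 1) : Differentiable ℂ fun a => qPochInf a Q := by
  have key (r : ℝ) : DifferentiableOn ℂ (fun a => qPochInf a Q) (ball 0 r) := by
    have hP : HasProdLocallyUniformlyOn (fun (j : ℕ) (a : ℂ) => 1 + -(a * Q ^ j))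
        (fun a => ∏' j : ℕ, (1 + -(a * Q ^ j))) (ball 0 r) := by
      refine Summable.hasProdLocallyUniformlyOn_nat_one_add (u := fun j => r * ‖Q‖ ^ j)
        isOpen_ball ((summable_geometric_of_lt_one (norm_nonneg Q) hQ).mul_left r) ?_ ?_
      · refine Eventually.of_forall fun j a ha => ?_
        rw [norm_neg, norm_mul, norm_pow]
        exact mul_le_mul_of_nonneg_right (mem_ball_zero_iff.mp ha).le (by positivity)
      · intro j
        fun_prop
    have := (hP.tendstoLocallyUniformlyOn_finsetRange).differentiableOn
      (Eventually.of_forall fun n => by fun_prop) isOpen_ball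
    simpa [qPochInf, sub_eq_add_neg] using this
  intro a
  exact (key (‖a‖ + 1)).differentiableAt (isOpen_ball.mem_nhds (by simp))

lemma exists_qPoch_bounds (hQ : ‖Q‖ < 1) {s : ℝ} (hs0 : 0 ≤ s) (hs : s < 1) :
    ∃ C : ℝ, ∀ a : ℂ, ‖a‖ ≤ s → ∀ k, ‖qPoch a Q k‖ ≤ C ∧ ‖qPoch a Q k‖⁻¹ ≤ C := by
  have hQ' : ‖(‖Q‖ : ℂ)‖ < 1 := by simpa using hQ
  have hs' : ‖(s : ℂ)‖ < 1 := by simpa [abs_of_nonneg hs0] using hs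
  obtain ⟨A, hA⟩ := (tendsto_qPoch hQ' (-(s : ℂ))).norm.bddAbove_range
  obtain ⟨B, hB⟩ := ((tendsto_qPoch hQ' (s : ℂ)).norm.inv₀
    (norm_ne_zero_iff.mpr (qPochInf_ne_zero hQ' hs'))).bddAbove_range
  have hle (a : ℂ) (ha : ‖a‖ ≤ s) (j : ℕ) : ‖a * Q ^ j‖ ≤ s * ‖Q‖ ^ j := by
    rw [norm_mul, norm_pow]
    exact mul_le_mul_of_nonneg_right ha (by positivity)
  have hlt (j : ℕ) : 0 < 1 - s * ‖Q‖ ^ j := sub_pos.mpr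
    (mul_lt_one_of_nonneg_of_lt_one_left hs0 hs (pow_le_one₀ (norm_nonneg Q) hQ.le))
  refine ⟨max A B, fun a ha k => ⟨le_max_of_le_left ?_, le_max_of_le_right ?_⟩⟩
  · refine le_trans ?_ (hA ⟨k, rfl⟩)
    simp only [qPoch, norm_prod]
    refine Finset.prod_le_prod (fun _ _ => norm_nonneg _) fun j _ => ?_
    have : (1 : ℂ) - -(s : ℂ) * (‖Q‖ : ℂ) ^ j = ((1 + s * ‖Q‖ ^ j : ℝ) : ℂ) := by
      push_cast
      ring
    rw [this, Complex.norm_real, Real.norm_of_nonneg (by positivity)]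
    exact (norm_sub_le _ _).trans (by simpa using hle a ha j)
  · refine le_trans ?_ (hB ⟨k, rfl⟩)
    simp only [qPoch, norm_prod]
    have hcast (j : ℕ) : ‖(1 : ℂ) - (s : ℂ) * (‖Q‖ : ℂ) ^ j‖ = 1 - s * ‖Q‖ ^ j := by
      rw [show (1 : ℂ) - (s : ℂ) * (‖Q‖ : ℂ) ^ j = ((1 - s * ‖Q‖ ^ j : ℝ) : ℂ) by push_cast; ring,
        Complex.norm_real, Real.norm_of_nonneg (hlt j).le]
    simp only [hcast]
    refine inv_anti₀ (Finset.prod_pos fun j _ => hlt j)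
      (Finset.prod_le_prod (fun j _ => (hlt j).le) fun j _ => ?_)
    have h1 := norm_sub_norm_le (1 : ℂ) (a * Q ^ j)
    rw [norm_one] at h1
    linarith [hle a ha j]

lemma tendsto_sum_pow_div_qPoch (hQ : ‖Q‖ < 1) :
    Tendsto (fun n => ∑ k ∈ Finset.range n, Q ^ k / qPoch Q Q k) atTop (𝓝 (qPochInf Q Q)⁻¹) := by
  have hsum (n : ℕ) : ∑ k ∈ Finset.range (n + 1), Q ^ k / qPoch Q Q k = (qPoch Q Q n)⁻¹ := by
    induction n with
    | zero => simp [qPoch]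
    | succ n ih =>
      have h := one_sub_mul_pow_ne_zero hQ hQ n
      have h' := qPoch_ne_zero hQ hQ n
      rw [Finset.sum_range_succ, ih, qPoch_succ]
      field_simp
      ring
  refine (tendsto_add_atTop_iff_nat 1).mp ?_
  simpa only [hsum] using (tendsto_qPoch hQ Q).inv₀ (qPochInf_ne_zero hQ hQ)

end Pochhammer

section Jost

/-- The coefficients `((a;Q)_k)² / ((a²;Q)_k (Q;Q)_k)` of the Jost-type series. -/
def jostCoeff (Q a : ℂ) (k : ℕ) : ℂ := qPoch a Q k ^ 2 / (qPoch (a ^ 2) Q k * qPoch Q Q k)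

/-- The Jost-type solution as a function of `a = q^{1-2iρ}`, with `Q = q²`. -/
def jost (Q a : ℂ) (N : ℕ) : ℂ := a ^ N * ∑' k : ℕ, jostCoeff Q a k * Q ^ k * Q ^ (k * N)

variable {Q : ℂ}

lemma norm_sq_lt_one {a : ℂ} (ha : ‖a‖ < 1) : ‖a ^ 2‖ < 1 := by
  rw [norm_pow]
  exact pow_lt_one₀ (norm_nonneg a) ha two_ne_zero

lemma jostCoeff_succ (hQ : ‖Q‖ < 1) {a : ℂ} (ha : ‖a‖ < 1) (k : ℕ) :
    jostCoeff Q a (k + 1) * ((1 - Q ^ (k + 1)) * (1 - a ^ 2 * Q ^ k)) =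
      jostCoeff Q a k * (1 - a * Q ^ k) ^ 2 := by
  have h1 := qPoch_ne_zero hQ hQ k
  have h2 := qPoch_ne_zero hQ (norm_sq_lt_one ha) k
  have h3 := one_sub_mul_pow_ne_zero hQ hQ k
  have h4 := one_sub_mul_pow_ne_zero hQ (norm_sq_lt_one ha) k
  rw [← pow_succ'] at h3
  simp only [jostCoeff, qPoch_succ, ← pow_succ']
  field_simp

lemma tendsto_jostCoeff (hQ : ‖Q‖ < 1) {a : ℂ} (ha : ‖a‖ < 1) :
    Tendsto (jostCoeff Q a) atTop
      (𝓝 (qPochInf a Q ^ 2 / (qPochInf (a ^ 2) Q * qPochInf Q Q))) :=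
  ((tendsto_qPoch hQ a).pow 2).div ((tendsto_qPoch hQ (a ^ 2)).mul (tendsto_qPoch hQ Q))
    (mul_ne_zero (qPochInf_ne_zero hQ (norm_sq_lt_one ha)) (qPochInf_ne_zero hQ hQ))

lemma exists_jostCoeff_bound (hQ : ‖Q‖ < 1) {s : ℝ} (hs : s < 1) :
    ∃ C : ℝ, ∀ a : ℂ, ‖a‖ ≤ s → ∀ k, ‖jostCoeff Q a k‖ ≤ C := by
  obtain ⟨C, hC⟩ := exists_qPoch_bounds hQ (s := max s ‖Q‖)
    (le_max_of_le_right (norm_nonneg Q)) (max_lt hs hQ)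
  have hC0 : 0 ≤ C := (norm_nonneg _).trans (hC Q (le_max_right _ _) 0).1
  refine ⟨C ^ 2 * (C * C), fun a ha k => ?_⟩
  have ha' : ‖a‖ ≤ max s ‖Q‖ := le_max_of_le_left ha
  have ha2 : ‖a ^ 2‖ ≤ max s ‖Q‖ := by
    rw [norm_pow, pow_two]
    exact (mul_le_of_le_one_left (norm_nonneg a) (ha.trans hs.le)).trans ha'
  rw [jostCoeff, norm_div, norm_pow, norm_mul, div_eq_mul_inv, mul_inv]
  have h1 := (hC a ha' k).1
  have h2 := (hC _ ha2 k).2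
  have h3 := (hC Q (le_max_right _ _) k).2
  gcongr

lemma norm_jost_term_le (hQ : ‖Q‖ < 1) {a : ℂ} {C : ℝ} (hC : ∀ k, ‖jostCoeff Q a k‖ ≤ C)
    (N k : ℕ) : ‖jostCoeff Q a k * Q ^ k * Q ^ (k * N)‖ ≤ C * ‖Q‖ ^ k := by
  rw [norm_mul, norm_mul, norm_pow, norm_pow]
  have h1 : ‖Q‖ ^ (k * N) ≤ 1 := pow_le_one₀ (norm_nonneg Q) hQ.le
  have h2 := hC k
  have h3 : 0 ≤ C := (norm_nonneg _).trans h2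
  calc ‖jostCoeff Q a k‖ * ‖Q‖ ^ k * ‖Q‖ ^ (k * N) ≤ C * ‖Q‖ ^ k * 1 := by gcongr
    _ = C * ‖Q‖ ^ k := mul_one _

lemma summable_const_mul_norm_pow (hQ : ‖Q‖ < 1) (C : ℝ) :
    Summable fun k : ℕ => C * ‖Q‖ ^ k :=
  (summable_geometric_of_lt_one (norm_nonneg Q) hQ).mul_left C

lemma hasSum_jost (hQ : ‖Q‖ < 1) {a : ℂ} (ha : ‖a‖ < 1) (N : ℕ) :
    HasSum (fun k : ℕ => jostCoeff Q a k * Q ^ k * (a * Q ^ k) ^ N) (jost Q a N) := by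
  obtain ⟨C, hC⟩ := exists_jostCoeff_bound hQ ha
  have hs : Summable fun k : ℕ => jostCoeff Q a k * Q ^ k * Q ^ (k * N) :=
    .of_norm_bounded (summable_const_mul_norm_pow hQ C)
      (norm_jost_term_le hQ (hC a le_rfl) N)
  convert! hs.hasSum.mul_left (a ^ N) using 2 with k
  rw [pow_mul]
  ring

lemma exists_norm_jost_le (hQ : ‖Q‖ < 1) {s : ℝ} (hs : s < 1) :
    ∃ C : ℝ, ∀ a : ℂ, ‖a‖ ≤ s → ∀ N, ‖jost Q a N‖ ≤ C * ‖a‖ ^ N := by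
  obtain ⟨C, hC⟩ := exists_jostCoeff_bound hQ hs
  refine ⟨∑' k : ℕ, C * ‖Q‖ ^ k, fun a ha N => ?_⟩
  rw [jost, norm_mul, norm_pow, mul_comm]
  gcongr
  exact tsum_of_norm_bounded (summable_const_mul_norm_pow hQ C).hasSum
    (norm_jost_term_le hQ (hC a ha) N)

lemma differentiableOn_jost (hQ : ‖Q‖ < 1) (N : ℕ) :
    DifferentiableOn ℂ (fun a => jost Q a N) (ball 0 1) := by
  intro a ha
  obtain ⟨s, has, hs⟩ := exists_between (mem_ball_zero_iff.mp ha)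
  obtain ⟨C, hC⟩ := exists_jostCoeff_bound hQ hs
  have hsum : DifferentiableOn ℂ
      (fun a => ∑' k : ℕ, jostCoeff Q a k * Q ^ k * Q ^ (k * N)) (ball 0 s) := by
    refine differentiableOn_tsum_of_summable_norm (summable_const_mul_norm_pow hQ C) ?_
      isOpen_ball fun k b hb => norm_jost_term_le hQ (hC b (mem_ball_zero_iff.mp hb).le) N k
    intro k
    refine DifferentiableOn.mul_const (DifferentiableOn.mul_const ?_ _) _
    refine DifferentiableOn.div ((differentiable_qPoch Q k).pow 2).differentiableOn ?_ ?_
    · exact (((differentiable_qPoch Q k).comp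
        (differentiable_id.pow 2)).mul_const _).differentiableOn
    · intro b hb
      exact mul_ne_zero
        (qPoch_ne_zero hQ (norm_sq_lt_one ((mem_ball_zero_iff.mp hb).trans hs)) k)
        (qPoch_ne_zero hQ hQ k)
  have hmem : ball (0 : ℂ) s ∈ 𝓝 a := isOpen_ball.mem_nhds (mem_ball_zero_iff.mpr has)
  exact ((differentiable_id.pow N).differentiableAt.mul
    (hsum.differentiableAt hmem)).differentiableWithinAt

/-- The Jost-type solution is an eigenfunction of the radial difference operator, up to a
boundary term at the origin. -/
lemma jost_recurrence (hQ : ‖Q‖ < 1) {a : ℂ} (ha : ‖a‖ < 1) (ha0 : a ≠ 0) (N : ℕ) :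
    Q * (1 - Q ^ N) * jost Q a (N - 1) + (1 - Q ^ (N + 1)) * jost Q a (N + 1) -
        (1 + Q - 2 * Q ^ (N + 1)) * jost Q a N =
      -((1 - a) * (1 - Q / a)) * jost Q a N -
        if N = 0 then qPochInf a Q ^ 2 / (qPochInf (a ^ 2) Q * qPochInf Q Q) * (Q / a) else 0 := by
  let e : ℕ → ℂ := fun k =>
    (a * Q ^ k) ^ N * jostCoeff Q a k * ((1 - Q ^ k) * (Q - a ^ 2 * Q ^ k)) / a
  have he_succ (k : ℕ) :
      e (k + 1) = (a * Q ^ k * Q) ^ N * Q * (jostCoeff Q a k * (1 - a * Q ^ k) ^ 2) / a := by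
    rw [← jostCoeff_succ hQ ha]
    simp only [e, pow_succ]
    ring
  have hterm (k : ℕ) :
      Q * (1 - Q ^ N) * (jostCoeff Q a k * Q ^ k * (a * Q ^ k) ^ (N - 1)) +
        (1 - Q ^ (N + 1)) * (jostCoeff Q a k * Q ^ k * (a * Q ^ k) ^ (N + 1)) -
        (1 + Q - 2 * Q ^ (N + 1)) * (jostCoeff Q a k * Q ^ k * (a * Q ^ k) ^ N) +
        (1 - a) * (1 - Q / a) * (jostCoeff Q a k * Q ^ k * (a * Q ^ k) ^ N) =
      e k - e (k + 1) := by
    rw [he_succ]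
    simp only [e]
    generalize jostCoeff Q a k = c
    generalize Q ^ k = y
    rcases N with _ | n
    · simp only [pow_zero, zero_add, pow_one]
      field_simp
      ring
    · simp only [Nat.add_sub_cancel]
      rw [mul_pow (a * y) Q]
      field_simp
      ring
  have hsum := ((((hasSum_jost hQ ha (N - 1)).mul_left (Q * (1 - Q ^ N))).add
    ((hasSum_jost hQ ha (N + 1)).mul_left (1 - Q ^ (N + 1)))).sub
    ((hasSum_jost hQ ha N).mul_left (1 + Q - 2 * Q ^ (N + 1)))).add
    ((hasSum_jost hQ ha N).mul_left ((1 - a) * (1 - Q / a)))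
  simp only [hterm] at hsum
  have hpart := hsum.tendsto_sum_nat
  simp only [Finset.sum_range_sub'] at hpart
  have hQk : Tendsto (fun k : ℕ => Q ^ k) atTop (𝓝 0) :=
    tendsto_pow_atTop_nhds_zero_of_norm_lt_one hQ
  have hlim : Tendsto e atTop (𝓝 ((a * 0) ^ N *
      (qPochInf a Q ^ 2 / (qPochInf (a ^ 2) Q * qPochInf Q Q)) *
        ((1 - 0) * (Q - a ^ 2 * 0)) / a)) :=
    ((((hQk.const_mul a).pow N).mul (tendsto_jostCoeff hQ ha)).mul
      ((hQk.const_sub 1).mul ((hQk.const_mul (a ^ 2)).const_sub Q))).div_const a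
  have heq := tendsto_nhds_unique hpart (hlim.const_sub (e 0))
  have he0 : e 0 = 0 := by simp [e]
  rw [he0] at heq
  split_ifs with hN
  · subst hN
    linear_combination heq
  · rw [mul_zero, zero_pow hN] at heq
    linear_combination heq

end Jost

section Laplacian

variable {q : ℝ}

lemma DeltaQ_apply (hq0 : q ≠ 0) (f : ℕ → ℂ) (N : ℕ) :
    DeltaQ q f N = ((1 - (q : ℂ) ^ 2) ^ 2)⁻¹ *
      ((q : ℂ) ^ 2 * (1 - ((q : ℂ) ^ 2) ^ N) * f (N - 1) +
        (1 - ((q : ℂ) ^ 2) ^ (N + 1)) * f (N + 1) -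
        (1 + (q : ℂ) ^ 2 - 2 * ((q : ℂ) ^ 2) ^ (N + 1)) * f N) := by
  have hq : (q : ℂ) ≠ 0 := by exact_mod_cast hq0
  by_cases h1 : (1 : ℂ) - (q : ℂ) ^ 2 = 0
  · have h2 : (q : ℂ) ^ (2 * (N : ℤ) - 1) - (q : ℂ) ^ (2 * (N : ℤ) + 1) = 0 := by
      rw [show 2 * (N : ℤ) + 1 = (2 * (N : ℤ) - 1) + 2 by ring, zpow_add₀ hq,
        show (q : ℂ) ^ (2 : ℤ) = (q : ℂ) ^ 2 by norm_cast, ← sub_eq_zero.mp h1]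
      ring
    rw [DeltaQ, h2, h1]
    simp
  have e1 : (q : ℂ) ^ (2 * (N : ℤ)) = ((q : ℂ) ^ 2) ^ N := by
    rw [zpow_mul]; norm_cast
  have e2 : (q : ℂ) ^ (4 * (N : ℤ)) = ((q : ℂ) ^ 2) ^ N * ((q : ℂ) ^ 2) ^ N := by
    rw [← e1, ← zpow_add₀ hq]; ring_nf
  have e3 : (q : ℂ) ^ (2 * (N : ℤ) + 2) = ((q : ℂ) ^ 2) ^ N * (q : ℂ) ^ 2 := by
    rw [zpow_add₀ hq, e1]; norm_cast
  have e4 : (q : ℂ) ^ (2 * (N : ℤ) - 2) = ((q : ℂ) ^ 2) ^ N / (q : ℂ) ^ 2 := by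
    rw [zpow_sub₀ hq, e1]; norm_cast
  have e5 : (q : ℂ) ^ (2 * (N : ℤ) - 1) = ((q : ℂ) ^ 2) ^ N / (q : ℂ) := by
    rw [zpow_sub₀ hq, e1, zpow_one]
  have e6 : (q : ℂ) ^ (2 * (N : ℤ) + 1) = ((q : ℂ) ^ 2) ^ N * (q : ℂ) := by
    rw [zpow_add₀ hq, e1, zpow_one]
  simp only [DeltaQ]
  rw [e1, e2, e3, e4, e5, e6, zpow_neg_one, pow_succ ((q : ℂ) ^ 2) N]
  have hy : ((q : ℂ) ^ 2) ^ N ≠ 0 := by positivity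
  have d1 : ((q : ℂ) ^ 2) ^ N / (q : ℂ) ^ 2 - ((q : ℂ) ^ 2) ^ N =
      ((q : ℂ) ^ 2) ^ N * (1 - (q : ℂ) ^ 2) / (q : ℂ) ^ 2 := by field_simp
  have d2 : ((q : ℂ) ^ 2) ^ N - ((q : ℂ) ^ 2) ^ N * (q : ℂ) ^ 2 =
      ((q : ℂ) ^ 2) ^ N * (1 - (q : ℂ) ^ 2) := by ring
  have d3 : ((q : ℂ) ^ 2) ^ N / (q : ℂ) - ((q : ℂ) ^ 2) ^ N * (q : ℂ) =
      ((q : ℂ) ^ 2) ^ N * (1 - (q : ℂ) ^ 2) / (q : ℂ) := by field_simp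
  rw [d1, d2, d3]
  split_ifs with hN
  · subst hN
    simp only [pow_zero] at *
    field_simp
    ring
  · generalize ((q : ℂ) ^ 2) ^ N = y at *
    field_simp
    ring

lemma tendsto_DeltaQ (hq : q ∈ Set.Ioo (0 : ℝ) 1) {f : ℕ → ℂ} (hf : Tendsto f atTop (𝓝 0)) :
    Tendsto (DeltaQ q f) atTop (𝓝 0) := by
  have hQ : ‖(q : ℂ) ^ 2‖ < 1 := norm_sq_lt_one (by simpa [abs_of_pos hq.1] using hq.2)
  have hQk : Tendsto (fun k : ℕ => ((q : ℂ) ^ 2) ^ k) atTop (𝓝 0) :=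
    tendsto_pow_atTop_nhds_zero_of_norm_lt_one hQ
  have hQk' := (tendsto_add_atTop_iff_nat 1).mpr hQk
  have h := ((((((hQk.const_sub 1).const_mul ((q : ℂ) ^ 2)).mul
    (hf.comp (tendsto_sub_atTop_nat 1))).add
    ((hQk'.const_sub 1).mul ((tendsto_add_atTop_iff_nat 1).mpr hf))).sub
    (((hQk'.const_mul 2).const_sub (1 + (q : ℂ) ^ 2)).mul hf)).const_mul
      ((1 - (q : ℂ) ^ 2) ^ 2)⁻¹)
  simp only [mul_zero, add_zero, sub_zero] at h
  exact h.congr fun N => (DeltaQ_apply hq.1.ne' f N).symm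

lemma DeltaQ_sub (hq0 : q ≠ 0) (f g : ℕ → ℂ) : DeltaQ q (f - g) = DeltaQ q f - DeltaQ q g := by
  ext N
  simp only [DeltaQ_apply hq0, Pi.sub_apply]
  ring

lemma one_sub_sq_ne_zero (hq : q ∈ Set.Ioo (0 : ℝ) 1) : (1 : ℂ) - (q : ℂ) ^ 2 ≠ 0 := by
  intro h
  have h' : (1 : ℝ) - q ^ 2 = 0 := by exact_mod_cast h
  nlinarith [hq.1, hq.2]

lemma eq_zero_of_DeltaQ_eq_zero (hq : q ∈ Set.Ioo (0 : ℝ) 1) {f : ℕ → ℂ}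
    (hf : Tendsto f atTop (𝓝 0)) (h : DeltaQ q f = 0) : f = 0 := by
  have hQ : ‖(q : ℂ) ^ 2‖ < 1 := norm_sq_lt_one (by simpa [abs_of_pos hq.1] using hq.2)
  have hstep (N : ℕ) : ((q : ℂ) ^ 2 * (1 - ((q : ℂ) ^ 2) ^ N)) * (f (N - 1) - f N) =
      (1 - ((q : ℂ) ^ 2) ^ (N + 1)) * (f N - f (N + 1)) := by
    have hN := congrFun h N
    rw [DeltaQ_apply hq.1.ne', Pi.zero_apply, mul_eq_zero] at hN
    have hN' := hN.resolve_left (inv_ne_zero (pow_ne_zero 2 (one_sub_sq_ne_zero hq)))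
    rw [pow_succ] at hN' ⊢
    linear_combination hN'
  have hne (N : ℕ) : 1 - ((q : ℂ) ^ 2) ^ (N + 1) ≠ 0 := by
    simpa [pow_succ'] using one_sub_mul_pow_ne_zero hQ hQ N
  have hconst (N : ℕ) : f N - f (N + 1) = 0 := by
    induction N with
    | zero =>
      have := hstep 0
      rw [pow_zero, sub_self, mul_zero, zero_mul] at this
      exact (mul_eq_zero.mp this.symm).resolve_left (hne 0)
    | succ n ih =>
      have := hstep (n + 1)
      rw [Nat.add_sub_cancel, ih, mul_zero] at this
      exact (mul_eq_zero.mp this.symm).resolve_left (hne (n + 1))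
  have hall (N : ℕ) : f N = f 0 := by
    induction N with
    | zero => rfl
    | succ n ih => rw [← ih, sub_eq_zero.mp (hconst n)]
  have h0 : f 0 = 0 := tendsto_nhds_unique (tendsto_const_nhds.congr fun N => (hall N).symm) hf
  ext N
  rw [hall N, h0, Pi.zero_apply]

lemma DeltaQ_injOn (hq : q ∈ Set.Ioo (0 : ℝ) 1) :
    Set.InjOn (DeltaQ q) {f | Tendsto f atTop (𝓝 0)} := by
  intro f hf g hg h
  have hfg : Tendsto (f - g) atTop (𝓝 0) := by
    have := Tendsto.sub hf hg
    rwa [sub_zero] at this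
  refine sub_eq_zero.mp (eq_zero_of_DeltaQ_eq_zero hq hfg ?_)
  rw [DeltaQ_sub hq.1.ne', h, sub_self]

end Laplacian

section Green

/-- The integrand of the Green function formula in the variable `z = q^{-2iρ}`. -/
def jostKernel (q : ℝ) (m N : ℕ) (z : ℂ) : ℂ :=
  jost ((q : ℂ) ^ 2) (q * z) N * qPochInf (z ^ 2) ((q : ℂ) ^ 2) /
    ((1 - q * z⁻¹) ^ m * (1 - q * z) ^ m * qPochInf (q * z) ((q : ℂ) ^ 2) ^ 2)

/-- The right-hand side of the Green function formula as an average over the unit circle. -/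
def jostGreen (q : ℝ) (m N : ℕ) : ℂ :=
  (-1) ^ m * (1 - (q : ℂ) ^ 2) ^ (2 * m) * qPochInf ((q : ℂ) ^ 2) ((q : ℂ) ^ 2) *
    Real.circleAverage (jostKernel q m N) 0 1

variable {q : ℝ}

lemma norm_ofReal_lt_one (hq : q ∈ Set.Ioo (0 : ℝ) 1) : ‖(q : ℂ)‖ < 1 := by
  simpa [abs_of_pos hq.1] using hq.2

lemma norm_ofReal_mul_of_mem_sphere {z : ℂ} (hz : z ∈ sphere (0 : ℂ) 1) :
    ‖(q : ℂ) * z‖ = ‖(q : ℂ)‖ := by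
  rw [norm_mul, mem_sphere_zero_iff_norm.mp hz, mul_one]

lemma inv_mem_unit_sphere {z : ℂ} (hz : z ∈ sphere (0 : ℂ) 1) : z⁻¹ ∈ sphere (0 : ℂ) 1 := by
  rw [mem_sphere_zero_iff_norm] at hz ⊢
  rw [norm_inv, hz, inv_one]

lemma one_sub_ofReal_mul_ne_zero (hq : q ∈ Set.Ioo (0 : ℝ) 1) {z : ℂ}
    (hz : z ∈ sphere (0 : ℂ) 1) : 1 - (q : ℂ) * z ≠ 0 := by
  have h : ‖(q : ℂ) * z‖ < 1 := by
    rw [norm_ofReal_mul_of_mem_sphere hz]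
    exact norm_ofReal_lt_one hq
  simpa using one_sub_mul_pow_ne_zero (Q := 0) (by simp) h 0

lemma norm_ofReal_mul_lt_one (hq : q ∈ Set.Ioo (0 : ℝ) 1) {z : ℂ} (hz : z ∈ ball (0 : ℂ) q⁻¹) :
    ‖(q : ℂ) * z‖ < 1 := by
  rw [norm_mul, Complex.norm_real, Real.norm_of_nonneg hq.1.le]
  have := mul_lt_mul_of_pos_left (mem_ball_zero_iff.mp hz) hq.1
  rwa [mul_inv_cancel₀ hq.1.ne'] at this

lemma differentiableOn_jostWeight (hq : q ∈ Set.Ioo (0 : ℝ) 1) :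
    DifferentiableOn ℂ
      (fun z : ℂ => qPochInf (z ^ 2) ((q : ℂ) ^ 2) / qPochInf (q * z) ((q : ℂ) ^ 2) ^ 2)
      (ball 0 q⁻¹) := by
  have hQ := norm_sq_lt_one (norm_ofReal_lt_one hq)
  have hP := differentiable_qPochInf hQ
  refine DifferentiableOn.div (hP.comp (differentiable_id.pow 2)).differentiableOn
    ((hP.comp (differentiable_id.const_mul (q : ℂ))).pow 2).differentiableOn fun z hz => ?_
  exact pow_ne_zero 2 (qPochInf_ne_zero hQ (norm_ofReal_mul_lt_one hq hz))

lemma differentiableOn_jostKernel_zero (hq : q ∈ Set.Ioo (0 : ℝ) 1) (N : ℕ) :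
    DifferentiableOn ℂ (jostKernel q 0 N) (ball 0 q⁻¹) := by
  have hQ := norm_sq_lt_one (norm_ofReal_lt_one hq)
  have hmul : Differentiable ℂ fun z : ℂ => (q : ℂ) * z := by fun_prop
  unfold jostKernel
  simp only [pow_zero, one_mul, mul_div_assoc]
  exact ((differentiableOn_jost hQ N).comp hmul.differentiableOn
    fun z hz => mem_ball_zero_iff.mpr (norm_ofReal_mul_lt_one hq hz)).mul
      (differentiableOn_jostWeight hq)

lemma closedBall_subset_ball_inv (hq : q ∈ Set.Ioo (0 : ℝ) 1) :
    closedBall (0 : ℂ) 1 ⊆ ball 0 q⁻¹ :=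
  closedBall_subset_ball ((one_lt_inv₀ hq.1).mpr hq.2)

lemma continuousOn_resolvent_factor (hq : q ∈ Set.Ioo (0 : ℝ) 1) (m : ℕ) :
    ContinuousOn (fun z : ℂ => ((1 - q * z⁻¹) ^ m * (1 - q * z) ^ m)⁻¹) (sphere 0 1) := by
  refine ContinuousOn.inv₀ (ContinuousOn.mul (ContinuousOn.pow ?_ m)
    (Continuous.continuousOn (by fun_prop))) fun z hz => ?_
  · exact continuousOn_const.sub (continuousOn_const.mul
      (continuousOn_inv₀.mono fun z hz => ne_zero_of_mem_unit_sphere ⟨z, hz⟩))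
  · exact mul_ne_zero (pow_ne_zero m (one_sub_ofReal_mul_ne_zero hq (inv_mem_unit_sphere hz)))
      (pow_ne_zero m (one_sub_ofReal_mul_ne_zero hq hz))

lemma jostKernel_eq (q : ℝ) (m N : ℕ) (z : ℂ) :
    jostKernel q m N z = jostKernel q 0 N z * ((1 - q * z⁻¹) ^ m * (1 - q * z) ^ m)⁻¹ := by
  simp only [jostKernel, pow_zero, one_mul, div_eq_mul_inv, mul_inv]
  ring

lemma continuousOn_jostKernel (hq : q ∈ Set.Ioo (0 : ℝ) 1) (m N : ℕ) :
    ContinuousOn (jostKernel q m N) (sphere 0 1) := by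
  refine ContinuousOn.congr ?_ fun z _ => jostKernel_eq q m N z
  exact ((differentiableOn_jostKernel_zero hq N).continuousOn.mono
    (sphere_subset_closedBall.trans (closedBall_subset_ball_inv hq))).mul
      (continuousOn_resolvent_factor hq m)

lemma jostGreen_zero (hq : q ∈ Set.Ioo (0 : ℝ) 1) : jostGreen q 0 = fZero := by
  have hQ := norm_sq_lt_one (norm_ofReal_lt_one hq)
  ext N
  have hd : DiffContOnCl ℂ (jostKernel q 0 N) (ball 0 |1|) := by
    rw [abs_one]
    refine DifferentiableOn.diffContOnCl_ball (differentiableOn_jostKernel_zero hq N)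
      (closedBall_subset_ball_inv hq)
  have hP0 : qPochInf 0 ((q : ℂ) ^ 2) = 1 := by simp [qPochInf]
  have hval : jostKernel q 0 N 0 = jost ((q : ℂ) ^ 2) 0 N := by
    simp [jostKernel, hP0]
  rw [jostGreen, hd.circleAverage, hval, fZero]
  split_ifs with hN
  · subst hN
    have hsum := hasSum_jost hQ (a := 0) (by simp) 0
    have hPoch (k : ℕ) : qPoch 0 ((q : ℂ) ^ 2) k = 1 := by simp [qPoch]
    have heq : jost ((q : ℂ) ^ 2) 0 0 = (qPochInf ((q : ℂ) ^ 2) ((q : ℂ) ^ 2))⁻¹ := by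
      refine tendsto_nhds_unique hsum.tendsto_sum_nat ((tendsto_sum_pow_div_qPoch hQ).congr fun n => ?_)
      refine Finset.sum_congr rfl fun k _ => ?_
      simp only [jostCoeff, hPoch, pow_zero, mul_one, one_pow, one_mul, ne_eq, OfNat.ofNat_ne_zero,
        not_false_eq_true, zero_pow]
      ring
    rw [heq]
    simp [qPochInf_ne_zero hQ hQ]
  · simp [jost, hN]

/-- The boundary term produced by the Laplacian at the origin is odd under `z ↦ z⁻¹`. -/
lemma circleAverage_boundary (q : ℝ) (m : ℕ) :
    Real.circleAverage
      (fun z : ℂ => (z⁻¹ - z) * ((1 - q * z⁻¹) ^ m * (1 - q * z) ^ m)⁻¹) 0 1 = 0 := by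
  set B : ℂ → ℂ := fun z => (z⁻¹ - z) * ((1 - q * z⁻¹) ^ m * (1 - q * z) ^ m)⁻¹ with hB
  have hodd : (fun z => B z⁻¹) = fun z => (-1 : ℂ) • B z := by
    ext z
    simp only [hB, inv_inv, smul_eq_mul]
    rw [mul_comm ((1 - q * z) ^ m)]
    ring
  have h : Real.circleAverage (fun z => B z⁻¹) 0 1 = Real.circleAverage B 0 1 :=
    Real.circleAverage_zero_one_congr_inv
  rw [hodd, Real.circleAverage_fun_smul, smul_eq_mul] at h
  linear_combination (-1 / 2 : ℂ) * h

lemma jostKernel_recurrence (hq : q ∈ Set.Ioo (0 : ℝ) 1) (m N : ℕ) {z : ℂ}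
    (hz : z ∈ sphere (0 : ℂ) 1) :
    (q : ℂ) ^ 2 * (1 - ((q : ℂ) ^ 2) ^ N) * jostKernel q (m + 1) (N - 1) z +
        (1 - ((q : ℂ) ^ 2) ^ (N + 1)) * jostKernel q (m + 1) (N + 1) z -
        (1 + (q : ℂ) ^ 2 - 2 * ((q : ℂ) ^ 2) ^ (N + 1)) * jostKernel q (m + 1) N z =
      -jostKernel q m N z -
        (if N = 0 then (q : ℂ) / qPochInf ((q : ℂ) ^ 2) ((q : ℂ) ^ 2) else 0) *
          ((z⁻¹ - z) * ((1 - q * z⁻¹) ^ (m + 1) * (1 - q * z) ^ (m + 1))⁻¹) := by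
  have hQ := norm_sq_lt_one (norm_ofReal_lt_one hq)
  have hq0 : (q : ℂ) ≠ 0 := by exact_mod_cast hq.1.ne'
  have hz0 : z ≠ 0 := ne_zero_of_mem_unit_sphere ⟨z, hz⟩
  have ha : ‖(q : ℂ) * z‖ < 1 := by
    rw [norm_ofReal_mul_of_mem_sphere hz]
    exact norm_ofReal_lt_one hq
  have hrec := jost_recurrence hQ ha (mul_ne_zero hq0 hz0) N
  have hdiv : (q : ℂ) ^ 2 / (q * z) = q * z⁻¹ := by field_simp
  have hPz : qPochInf (z ^ 2) ((q : ℂ) ^ 2) =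
      (1 - z ^ 2) * qPochInf (((q : ℂ) * z) ^ 2) ((q : ℂ) ^ 2) := by
    rw [qPochInf_eq_mul hQ (z ^ 2)]
    ring_nf
  have h1 := one_sub_ofReal_mul_ne_zero hq hz
  have h2 := one_sub_ofReal_mul_ne_zero hq (inv_mem_unit_sphere hz)
  have h3 := qPochInf_ne_zero hQ ha
  have h4 := qPochInf_ne_zero hQ (norm_sq_lt_one ha)
  have h5 := qPochInf_ne_zero hQ hQ
  rw [hdiv] at hrec
  simp only [jostKernel]
  set D : ℂ := (1 - q * z⁻¹) ^ (m + 1) * (1 - q * z) ^ (m + 1) *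
    qPochInf (q * z) ((q : ℂ) ^ 2) ^ 2 with hD
  have hm : jost ((q : ℂ) ^ 2) (q * z) N * qPochInf (z ^ 2) ((q : ℂ) ^ 2) /
      ((1 - q * z⁻¹) ^ m * (1 - q * z) ^ m * qPochInf (q * z) ((q : ℂ) ^ 2) ^ 2) =
      (1 - q * z) * (1 - q * z⁻¹) * jost ((q : ℂ) ^ 2) (q * z) N *
        qPochInf (z ^ 2) ((q : ℂ) ^ 2) / D := by
    rw [hD, pow_succ, pow_succ]
    generalize (1 : ℂ) - q * z⁻¹ = u at *
    generalize (1 : ℂ) - q * z = v at *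
    field_simp
    ring
  have hbd : (if N = 0 then qPochInf (q * z) ((q : ℂ) ^ 2) ^ 2 /
        (qPochInf (((q : ℂ) * z) ^ 2) ((q : ℂ) ^ 2) * qPochInf ((q : ℂ) ^ 2) ((q : ℂ) ^ 2)) *
          (q * z⁻¹) else 0) * qPochInf (z ^ 2) ((q : ℂ) ^ 2) / D =
      (if N = 0 then (q : ℂ) / qPochInf ((q : ℂ) ^ 2) ((q : ℂ) ^ 2) else 0) *
          ((z⁻¹ - z) * ((1 - q * z⁻¹) ^ (m + 1) * (1 - q * z) ^ (m + 1))⁻¹) := by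
    split_ifs with hN
    · have hzz : z⁻¹ - z = z⁻¹ * (1 - z ^ 2) := by field_simp
      rw [hD, hPz, hzz]
      generalize qPochInf (((q : ℂ) * z) ^ 2) ((q : ℂ) ^ 2) = p at *
      generalize (1 : ℂ) - q * z⁻¹ = u at *
      generalize (1 : ℂ) - q * z = v at *
      field_simp
    · simp
  rw [hm, ← hbd]
  linear_combination (qPochInf (z ^ 2) ((q : ℂ) ^ 2) / D) * hrec

lemma DeltaQ_jostGreen (hq : q ∈ Set.Ioo (0 : ℝ) 1) (m : ℕ) :
    DeltaQ q (jostGreen q (m + 1)) = jostGreen q m := by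
  ext N
  have hint (m N : ℕ) : CircleIntegrable (jostKernel q m N) 0 1 :=
    (continuousOn_jostKernel hq m N).circleIntegrable zero_le_one
  have hintB : CircleIntegrable (fun z : ℂ =>
      (z⁻¹ - z) * ((1 - q * z⁻¹) ^ (m + 1) * (1 - q * z) ^ (m + 1))⁻¹) 0 1 := by
    refine ContinuousOn.circleIntegrable zero_le_one
      (ContinuousOn.mul ?_ (continuousOn_resolvent_factor hq (m + 1)))
    exact (continuousOn_inv₀.mono fun z hz => ne_zero_of_mem_unit_sphere ⟨z, hz⟩).sub continuousOn_id
  have havg := Real.circleAverage_congr_sphere (c := 0) (R := 1)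
    (fun z hz => jostKernel_recurrence hq m N (by simpa using hz))
  have hmul (c : ℂ) {f : ℂ → ℂ} (hf : CircleIntegrable f 0 1) :
      CircleIntegrable (fun z => c * f z) 0 1 := hf.const_fun_smul
  have hadd (c d : ℂ) {f g : ℂ → ℂ} (hf : CircleIntegrable f 0 1) (hg : CircleIntegrable g 0 1) :
      CircleIntegrable (fun z => c * f z + d * g z) 0 1 := (hmul c hf).add (hmul d hg)
  rw [Real.circleAverage_fun_sub (hadd _ _ (hint _ _) (hint _ _)) (hmul _ (hint _ _)),
    Real.circleAverage_fun_add (hmul _ (hint _ _)) (hmul _ (hint _ _)),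
    Real.circleAverage_fun_sub (f₁ := fun z => -jostKernel q m N z) (hint m N).neg
      (hmul _ hintB)] at havg
  have hneg : (fun z => -jostKernel q m N z) = fun z => (-1 : ℂ) • jostKernel q m N z := by
    ext z
    simp
  simp only [hneg, ← smul_eq_mul, Real.circleAverage_fun_smul] at havg
  simp only [smul_eq_mul, circleAverage_boundary, mul_zero, sub_zero] at havg
  have hne := one_sub_sq_ne_zero hq
  rw [DeltaQ_apply hq.1.ne', inv_mul_eq_iff_eq_mul₀ (pow_ne_zero 2 hne)]
  simp only [jostGreen]
  linear_combination ((-1) ^ (m + 1) * (1 - (q : ℂ) ^ 2) ^ (2 * (m + 1)) *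
    qPochInf ((q : ℂ) ^ 2) ((q : ℂ) ^ 2)) * havg

lemma norm_circleAverage_le {f : ℂ → ℂ} {C : ℝ} (hf : ∀ z ∈ sphere (0 : ℂ) 1, ‖f z‖ ≤ C) :
    ‖Real.circleAverage f 0 1‖ ≤ C := by
  have h := intervalIntegral.norm_integral_le_of_norm_le_const (a := 0) (b := 2 * Real.pi)
    (f := fun θ => f (circleMap 0 1 θ)) (C := C)
    fun θ _ => hf _ (circleMap_mem_sphere 0 zero_le_one θ)
  rw [sub_zero, abs_of_pos Real.two_pi_pos] at h
  rw [Real.circleAverage_def, norm_smul, norm_inv, Real.norm_of_nonneg Real.two_pi_pos.le,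
    inv_mul_le_iff₀ Real.two_pi_pos]
  linarith

lemma tendsto_jostGreen (hq : q ∈ Set.Ioo (0 : ℝ) 1) (m : ℕ) :
    Tendsto (jostGreen q m) atTop (𝓝 0) := by
  have hq1 := norm_ofReal_lt_one hq
  obtain ⟨C, hC⟩ := exists_norm_jost_le (norm_sq_lt_one hq1) hq1
  obtain ⟨W, hW⟩ := (isCompact_sphere (0 : ℂ) 1).exists_bound_of_continuousOn
    (((differentiableOn_jostWeight hq).continuousOn.mono
      (sphere_subset_closedBall.trans (closedBall_subset_ball_inv hq))).mul
        (continuousOn_resolvent_factor hq m))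
  have hbound (N : ℕ) :
      ‖Real.circleAverage (jostKernel q m N) 0 1‖ ≤ C * ‖(q : ℂ)‖ ^ N * W := by
    refine norm_circleAverage_le fun z hz => ?_
    have hK : jostKernel q m N z = jost ((q : ℂ) ^ 2) (q * z) N *
        (qPochInf (z ^ 2) ((q : ℂ) ^ 2) / qPochInf (q * z) ((q : ℂ) ^ 2) ^ 2 *
          ((1 - q * z⁻¹) ^ m * (1 - q * z) ^ m)⁻¹) := by
      simp only [jostKernel, div_eq_mul_inv, mul_inv]
      ring
    have hz' := norm_ofReal_mul_of_mem_sphere (q := q) hz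
    have hJ := hC _ hz'.le N
    rw [hz'] at hJ
    rw [hK, norm_mul]
    exact mul_le_mul hJ (hW z hz) (norm_nonneg _) ((norm_nonneg _).trans hJ)
  have hlim : Tendsto (fun N : ℕ => C * ‖(q : ℂ)‖ ^ N * W) atTop (𝓝 0) := by
    simpa using ((tendsto_pow_atTop_nhds_zero_of_lt_one (norm_nonneg (q : ℂ)) hq1).const_mul
      C).mul_const W
  have h := (squeeze_zero_norm hbound hlim).const_mul ((-1) ^ m * (1 - (q : ℂ) ^ 2) ^ (2 * m) *
    qPochInf ((q : ℂ) ^ 2) ((q : ℂ) ^ 2))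
  rwa [mul_zero] at h

lemma eq_jostGreen (hq : q ∈ Set.Ioo (0 : ℝ) 1) (m : ℕ) {g : ℕ → ℂ}
    (hg : Tendsto g atTop (𝓝 0)) (hgm : (DeltaQ q)^[m] g = fZero) : g = jostGreen q m := by
  induction m generalizing g with
  | zero => rw [jostGreen_zero hq, ← hgm, Function.iterate_zero_apply]
  | succ m ih =>
    rw [Function.iterate_succ_apply] at hgm
    refine DeltaQ_injOn hq hg (tendsto_jostGreen hq (m + 1)) ?_
    rw [DeltaQ_jostGreen hq, ih (tendsto_DeltaQ hq hg) hgm]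

lemma tendsto_zero_of_summable_weighted (hq : q ∈ Set.Ioo (0 : ℝ) 1) {g : ℕ → ℂ}
    (hg : Summable fun N : ℕ => ‖g N‖ ^ 2 * q ^ (-(2 * (N : ℤ)))) : Tendsto g atTop (𝓝 0) := by
  have h2 : Tendsto (fun N => ‖g N‖ ^ 2) atTop (𝓝 0) := by
    refine squeeze_zero (fun N => by positivity) (fun N => ?_) hg.tendsto_atTop_zero
    have : (1 : ℝ) ≤ q ^ (-(2 * (N : ℤ))) := by
      rw [zpow_neg]
      refine (one_le_inv₀ (zpow_pos hq.1 _)).mpr ?_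
      exact_mod_cast pow_le_one₀ (n := 2 * N) hq.1.le hq.2.le
    exact le_mul_of_one_le_right (by positivity) this
  refine tendsto_zero_iff_norm_tendsto_zero.mpr ?_
  simpa using h2.sqrt

end Green

section Parametrization

variable {q : ℝ}

lemma hQ_eq (q : ℝ) : hQ q = -2 * Real.log q := by
  rw [hQ, Real.log_zpow]
  norm_num

lemma hQ_pos (hq : q ∈ Set.Ioo (0 : ℝ) 1) : 0 < hQ q := by
  rw [hQ_eq]
  linarith [Real.log_neg hq.1 hq.2]

lemma circleMap_hQ_mul (q ρ : ℝ) : circleMap 0 1 (hQ q * ρ) = qpow q (-(2 * I * ρ)) := by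
  rw [circleMap, qpow, hQ_eq, zero_add, ofReal_one, one_mul]
  push_cast
  ring_nf

lemma qpow_add (q : ℝ) (v w : ℂ) : qpow q (v + w) = qpow q v * qpow q w := by
  rw [qpow, add_mul, Complex.exp_add, qpow, qpow]

lemma qpow_neg (q : ℝ) (w : ℂ) : qpow q (-w) = (qpow q w)⁻¹ := by
  rw [qpow, neg_mul, Complex.exp_neg, qpow]

lemma qpow_mul_natCast (q : ℝ) (w : ℂ) (n : ℕ) : qpow q (w * n) = qpow q w ^ n := by
  rw [qpow, qpow, ← Complex.exp_nat_mul]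
  ring_nf

lemma qpow_one (hq : 0 < q) : qpow q 1 = q := by
  rw [qpow, one_mul, ← ofReal_exp, Real.exp_log hq]

lemma psiQ_eq_jost (q ρ : ℝ) (N : ℕ) :
    psiQ q ρ N = jost ((q : ℂ) ^ 2) (qpow q (1 - 2 * I * ρ)) N := by
  have h2 : qpow q (2 - 4 * I * ρ) = qpow q (1 - 2 * I * ρ) ^ 2 := by
    rw [← qpow_mul_natCast]
    push_cast
    ring_nf
  rw [psiQ, jost, qpow_mul_natCast]
  congr 1
  refine tsum_congr fun k => ?_
  rw [psiTerm, jostCoeff, h2, ← pow_mul, ← pow_mul, mul_assoc 2 k N]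
  ring

lemma integrand_eq_jostKernel (hq : 0 < q) (m N : ℕ) (ρ : ℝ) :
    psiQ q (ρ : ℂ) N * qPochInf (qpow q (-(4 * I * (ρ : ℂ)))) ((q : ℂ) ^ 2) /
      ((1 - qpow q (1 + 2 * I * (ρ : ℂ))) ^ m * (1 - qpow q (1 - 2 * I * (ρ : ℂ))) ^ m *
        (qPochInf (qpow q (1 - 2 * I * (ρ : ℂ))) ((q : ℂ) ^ 2)) ^ 2) =
      jostKernel q m N (circleMap 0 1 (hQ q * ρ)) := by
  have h1 : qpow q (1 - 2 * I * ρ) = q * circleMap 0 1 (hQ q * ρ) := by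
    rw [circleMap_hQ_mul, sub_eq_add_neg, qpow_add, qpow_one hq]
  have h2 : qpow q (1 + 2 * I * ρ) = q * (circleMap 0 1 (hQ q * ρ))⁻¹ := by
    rw [circleMap_hQ_mul, qpow_add, qpow_one hq, qpow_neg, inv_inv]
  have h3 : qpow q (-(4 * I * ρ)) = circleMap 0 1 (hQ q * ρ) ^ 2 := by
    rw [circleMap_hQ_mul, ← qpow_mul_natCast]
    push_cast
    ring_nf
  rw [psiQ_eq_jost, h1, h2, h3, jostKernel]

lemma circleAverage_eq_setIntegral {h : ℝ} (hh : 0 < h) (f : ℂ → ℂ) :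
    Real.circleAverage f 0 1 = (h : ℂ) / (2 * (Real.pi : ℂ)) *
      ∫ ρ : ℝ in Set.Icc (0 : ℝ) (2 * Real.pi / h), f (circleMap 0 1 (h * ρ)) := by
  rw [MeasureTheory.integral_Icc_eq_integral_Ioc,
    ← intervalIntegral.integral_of_le (by positivity),
    intervalIntegral.integral_comp_mul_left (fun θ => f (circleMap 0 1 θ)) hh.ne', mul_zero,
    mul_div_cancel₀ _ hh.ne', Real.circleAverage_def, Complex.real_smul, Complex.real_smul]
  have : (h : ℂ) ≠ 0 := by exact_mod_cast hh.ne'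
  push_cast
  field_simp

end Parametrization

/-- if `g ∈ L²(dν)q⁰` satisfies `Δ^m g = f₀` (`m ≥ 1`), then
`g(q^{2N}) = ((−1)^m h/(2π)) (1−q²)^{2m} (q²;q²)_∞ ·`
`∫_0^{2π/h} ψ_ρ(q^{2N}) (q^{−4iρ};q²)_∞ / ((1−q^{1+2iρ})^m (1−q^{1−2iρ})^m ((q^{1−2iρ};q²)_∞)²) dρ`,
the integral being with respect to Lebesgue measure on `[0, 2π/h]`. -/
theorem green_function_jost_formula (q : ℝ) (hq : q ∈ Set.Ioo (0 : ℝ) 1)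
    (m : ℕ) (hm : 1 ≤ m) (g : ℕ → ℂ)
    (hg : Summable (fun N : ℕ => ‖g N‖ ^ 2 * q ^ (-(2 * (N : ℤ)))))
    (hgm : (DeltaQ q)^[m] g = fZero) :
    ∀ N : ℕ,
      g N = (-1 : ℂ) ^ m * (hQ q : ℂ) / (2 * (Real.pi : ℂ)) * (1 - (q : ℂ) ^ 2) ^ (2 * m) *
        qPochInf ((q : ℂ) ^ 2) ((q : ℂ) ^ 2) *
        ∫ ρ : ℝ in Set.Icc (0 : ℝ) (2 * Real.pi / hQ q),
          psiQ q (ρ : ℂ) N * qPochInf (qpow q (-(4 * I * (ρ : ℂ)))) ((q : ℂ) ^ 2) /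
            ((1 - qpow q (1 + 2 * I * (ρ : ℂ))) ^ m * (1 - qpow q (1 - 2 * I * (ρ : ℂ))) ^ m *
              (qPochInf (qpow q (1 - 2 * I * (ρ : ℂ))) ((q : ℂ) ^ 2)) ^ 2) := by
  intro N
  have hgN := congrFun (eq_jostGreen hq m (tendsto_zero_of_summable_weighted hq hg) hgm) N
  simp only [integrand_eq_jostKernel hq.1]
  rw [hgN, jostGreen, circleAverage_eq_setIntegral (hQ_pos hq)]
  ring

end
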